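/- Let L be a positive integer, W an m×n integer matrix, and a, r integer vectors of length n. Define ã by ã_j = (a_j + r_j) mod L and c = W·r. If every component of W·a satisfies 0 ≤ (W·a)_i < L, then taking the componentwise mod L of W·ã − c recovers W·a exactly: for every i, ((W·ã)_i − c_i) mod L = (W·a)_i. In particular, the unmasking step of the secure inference protocol computes the exact unmasked result W·a. -/

import Mathlib

/-- If every component of `W·a` lies in `[0, L)`, then the unmasking
step recovers `W·a` exactly: `((W·ã)_i − c_i) mod L = (W·a)_i`, where
`ã j = (a j + r j) mod L` and `c = W·r`. -/
theorem unmasking_recovers_exactly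
    (m n : ℕ) (L : ℤ) (hL : 0 < L)
    (W : Matrix (Fin m) (Fin n) ℤ) (a r : Fin n → ℤ)
    (hfits : ∀ i : Fin m, 0 ≤ W.mulVec a i ∧ W.mulVec a i < L) :
    ∀ i : Fin m,
      (W.mulVec (fun j => (a j + r j) % L) i - W.mulVec r i) % L = W.mulVec a i := by
  intro i
  obtain ⟨h0, h1⟩ := hfits i
  conv_rhs => rw [← Int.emod_eq_of_lt h0 h1]
  rw [Int.emod_eq_emod_iff_emod_sub_eq_zero]
  apply Int.emod_eq_zero_of_dvd
  simp only [Matrix.mulVec, dotProduct]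
  rw [← Finset.sum_sub_distrib, ← Finset.sum_sub_distrib]
  apply Finset.dvd_sum
  intro j _
  refine ⟨-(W i j * ((a j + r j) / L)), ?_⟩
  have h := Int.emod_add_mul_ediv (a j + r j) L
  linear_combination W i j * h
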